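/- Let Λ ⊆ ℂ be a lattice, let s ∈ ℂ satisfy ns ∉ Λ for every integer n ≥ 1, let R and R' be two pinnings, and let f be an elliptic function for Λ. For each r ∈ R let r' ∈ R', n_r ∈ ℤ and λ_r ∈ Λ be the unique elements with r' = r + n_r·s + λ_r. Then pano_{R'}(f,1) = pano_R(f,1) − Σ_{r∈R} n_r·ores(f,r,1) (a sum with finitely many nonzero terms). In particular, if ores(f,r,1) = 0 for every r ∈ R, then pano_{R'}(f,1) = pano_R(f,1). -/

import Mathlib

open Filter Topology Set

/-- The Weierstrass zeta function of a lattice `L ⊆ ℂ`. -/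
noncomputable def wzeta (L : Set ℂ) (z : ℂ) : ℂ :=
  1 / z + ∑' l : ↥(L \ {0}), (1 / (z - (l : ℂ)) + 1 / (l : ℂ) + z / (l : ℂ) ^ 2)

/-- `L` is a lattice in `ℂ`. -/
def IsLattice (L : Set ℂ) : Prop :=
  ∃ ω₁ ω₂ : ℂ, LinearIndependent ℝ ![ω₁, ω₂] ∧
    L = {z : ℂ | ∃ m n : ℤ, z = (m : ℂ) * ω₁ + (n : ℂ) * ω₂}

/-- `F` extends analytically to the point `α`. -/
def ExtAnalyticAt (F : ℂ → ℂ) (α : ℂ) : Prop :=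
  ∃ g : ℂ → ℂ, AnalyticAt ℂ g α ∧ ∀ᶠ z in 𝓝[≠] α, F z = g z

/-- `f` is an elliptic function for the lattice `L`: meromorphic on `ℂ` and `L`-periodic. -/
def IsElliptic (L : Set ℂ) (f : ℂ → ℂ) : Prop :=
  MeromorphicOn f Set.univ ∧
    ∀ lam ∈ L, ∀ z : ℂ, AnalyticAt ℂ f z → f (z + lam) = f z

/-- `c : ℕ → ℂ` is the family of principal part coefficients of `f` at `α`
(`c k` is the coefficient of `1/(z-α)^k`; `c 0` is irrelevant and set to `0`). -/
def IsPrincPart (f : ℂ → ℂ) (α : ℂ) (c : ℕ → ℂ) : Prop :=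
  c 0 = 0 ∧ (Function.support c).Finite ∧
    ExtAnalyticAt (fun z => f z - ∑ᶠ k : ℕ, c k / (z - α) ^ k) α

/-- `R` is a pinning: `(r, n, λ) ↦ r + n s + λ` is a bijection from `R × ℤ × L` onto `ℂ`. -/
def IsPinning (L : Set ℂ) (s : ℂ) (R : Set ℂ) : Prop :=
  ∀ z : ℂ, ∃! p : ℂ × ℤ × ℂ, p.1 ∈ R ∧ p.2.2 ∈ L ∧ z = p.1 + (p.2.1 : ℂ) * s + p.2.2


theorem IsLattice.zero_mem {L : Set ℂ} (hL : IsLattice L) : (0 : ℂ) ∈ L := by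
  obtain ⟨ω₁, ω₂, -, rfl⟩ := hL
  exact ⟨0, 0, by simp⟩

theorem IsLattice.sub_mem {L : Set ℂ} (hL : IsLattice L) {x y : ℂ} (hx : x ∈ L) (hy : y ∈ L) :
    x - y ∈ L := by
  obtain ⟨ω₁, ω₂, -, rfl⟩ := hL
  obtain ⟨m, n, rfl⟩ := hx
  obtain ⟨m', n', rfl⟩ := hy
  exact ⟨m - m', n - n', by push_cast; ring⟩

/-- A compact set meets every coset of a lattice. -/
theorem IsLattice.exists_isCompact_add_mem {L : Set ℂ} (hL : IsLattice L) :
    ∃ K : Set ℂ, IsCompact K ∧ ∀ z : ℂ, ∃ l ∈ L, z + l ∈ K := by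
  obtain ⟨ω₁, ω₂, hli, rfl⟩ := hL
  refine ⟨(fun p : ℝ × ℝ => (p.1 : ℂ) * ω₁ + (p.2 : ℂ) * ω₂) '' (Icc 0 1 ×ˢ Icc 0 1),
    (isCompact_Icc.prod isCompact_Icc).image (by fun_prop), fun z => ?_⟩
  have hspan : Submodule.span ℝ (Set.range ![ω₁, ω₂]) = ⊤ :=
    hli.span_eq_top_of_card_eq_finrank' (by simp [Complex.finrank_real_complex])
  have hz : z ∈ Submodule.span ℝ {ω₁, ω₂} := by
    have : z ∈ Submodule.span ℝ (Set.range ![ω₁, ω₂]) := hspan ▸ Submodule.mem_top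
    simpa [Matrix.range_cons, Matrix.range_empty, Set.pair_comm] using this
  obtain ⟨a, b, rfl⟩ := Submodule.mem_span_pair.1 hz
  refine ⟨_, ⟨-⌊a⌋, -⌊b⌋, rfl⟩, (Int.fract a, Int.fract b),
    ⟨⟨Int.fract_nonneg a, (Int.fract_lt_one a).le⟩,
      ⟨Int.fract_nonneg b, (Int.fract_lt_one b).le⟩⟩, ?_⟩
  simp only [Int.fract, Complex.real_smul]
  push_cast
  ring

/-- A polynomial in `1 / (z - α)` that extends analytically to `α` is constant. -/
theorem Polynomial.degree_le_zero_of_extAnalyticAt {P : Polynomial ℂ} {α : ℂ}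
    (h : ExtAnalyticAt (fun z => P.eval (z - α)⁻¹) α) : P.degree ≤ 0 := by
  by_contra! hdeg
  obtain ⟨g, hg, hPg⟩ := h
  have hsub : Tendsto (fun z : ℂ => z - α) (𝓝[≠] α) (𝓝[≠] 0) := by
    refine tendsto_nhdsWithin_iff.2 ⟨?_, ?_⟩
    · exact (Continuous.tendsto' (by fun_prop) _ _ (by simp)).mono_left nhdsWithin_le_nhds
    · filter_upwards [self_mem_nhdsWithin] with z hz
      exact sub_ne_zero.2 hz
  have hinv : Tendsto (fun z : ℂ => ‖(z - α)⁻¹‖) (𝓝[≠] α) atTop :=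
    tendsto_norm_inv_nhdsNE_zero_atTop.comp hsub
  have h1 := P.tendsto_norm_atTop hdeg hinv
  have h2 : Tendsto (fun z => ‖P.eval (z - α)⁻¹‖) (𝓝[≠] α) (𝓝 ‖g α‖) :=
    (hg.continuousAt.tendsto.mono_left nhdsWithin_le_nhds).norm.congr'
      (hPg.mono fun z hz => by simp only [hz])
  exact not_tendsto_nhds_of_tendsto_atTop h1 _ h2

theorem IsPrincPart.congr {f g : ℂ → ℂ} {α : ℂ} {c : ℕ → ℂ} (hc : IsPrincPart f α c)
    (hfg : ∀ᶠ z in 𝓝[≠] α, f z = g z) : IsPrincPart g α c := by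
  obtain ⟨h0, hfin, F, hF, hfF⟩ := hc
  refine ⟨h0, hfin, F, hF, ?_⟩
  filter_upwards [hfF, hfg] with z h1 h2
  rw [← h1, h2]

theorem IsPrincPart.unique {f : ℂ → ℂ} {α : ℂ} {c d : ℕ → ℂ} (hc : IsPrincPart f α c)
    (hd : IsPrincPart f α d) : c = d := by
  obtain ⟨hc0, hcfin, F, hF, hfF⟩ := hc
  obtain ⟨hd0, hdfin, G, hG, hfG⟩ := hd
  have key (e : ℕ → ℂ) (he : (Function.support e).Finite) :
      ∃ P : Polynomial ℂ, (∀ k, P.coeff k = e k) ∧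
        ∀ z, ∑ᶠ k : ℕ, e k / (z - α) ^ k = P.eval (z - α)⁻¹ := by
    refine ⟨∑ k ∈ he.toFinset, Polynomial.monomial k (e k), fun k => ?_, fun z => ?_⟩
    · simp +contextual [Polynomial.finsetSum_coeff, Polynomial.coeff_monomial, eq_comm]
    · rw [finsum_eq_sum_of_support_subset (s := he.toFinset), Polynomial.eval_finsetSum]
      · simp [div_eq_mul_inv]
      · intro k hk
        simp only [Function.mem_support, ne_eq, div_eq_zero_iff, not_or] at hk
        simpa using hk.1
  obtain ⟨P, hPc, hP⟩ := key c hcfin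
  obtain ⟨Q, hQd, hQ⟩ := key d hdfin
  have hdeg : (P - Q).degree ≤ 0 := by
    refine Polynomial.degree_le_zero_of_extAnalyticAt (α := α) ⟨G - F, hG.sub hF, ?_⟩
    filter_upwards [hfF, hfG] with z h1 h2
    rw [hP] at h1
    rw [hQ] at h2
    rw [Pi.sub_apply, ← h1, ← h2, Polynomial.eval_sub]
    ring
  funext k
  rcases Nat.eq_zero_or_pos k with rfl | hk
  · rw [hc0, hd0]
  · have := Polynomial.coeff_eq_zero_of_degree_lt
      (hdeg.trans_lt (WithBot.coe_lt_coe.2 hk))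
    rwa [Polynomial.coeff_sub, hPc, hQd, sub_eq_zero] at this

theorem IsPrincPart.comp_add_right {f : ℂ → ℂ} {α l : ℂ} {c : ℕ → ℂ}
    (hc : IsPrincPart f (α + l) c) : IsPrincPart (fun z => f (z + l)) α c := by
  obtain ⟨h0, hfin, F, hF, hfF⟩ := hc
  refine ⟨h0, hfin, fun z => F (z + l), ?_, ?_⟩
  · exact AnalyticAt.fun_comp (f := fun z => z + l) hF (by fun_prop)
  · have ht : Tendsto (fun z : ℂ => z + l) (𝓝[≠] α) (𝓝[≠] (α + l)) := by
      refine tendsto_nhdsWithin_iff.2 ⟨?_, ?_⟩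
      · exact (Continuous.tendsto' (by fun_prop) _ _ rfl).mono_left nhdsWithin_le_nhds
      · filter_upwards [self_mem_nhdsWithin] with z hz
        simpa using hz
    filter_upwards [ht.eventually hfF] with z hz
    simpa using hz

theorem AnalyticAt.isPrincPart_zero {f : ℂ → ℂ} {α : ℂ} (hf : AnalyticAt ℂ f α) :
    IsPrincPart f α 0 :=
  ⟨rfl, by simp, f, hf, by simp⟩

theorem IsElliptic.princPart_add_mem {L : Set ℂ} {f : ℂ → ℂ} (hf : IsElliptic L f)
    {c : ℂ → ℕ → ℂ} (hc : ∀ α, IsPrincPart f α (c α)) {l : ℂ} (hl : l ∈ L) (α : ℂ) :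
    c (α + l) = c α := by
  refine (((hc (α + l)).comp_add_right).congr ?_).unique (hc α)
  filter_upwards [(hf.1 α (mem_univ _)).eventually_analyticAt] with z hz
  exact hf.2 l hl z hz

theorem MeromorphicOn.finite_princPart_ne_zero {f : ℂ → ℂ} (hf : MeromorphicOn f univ)
    {c : ℂ → ℕ → ℂ} (hc : ∀ α, IsPrincPart f α (c α)) {K : Set ℂ} (hK : IsCompact K) :
    (K ∩ {α | c α ≠ 0}).Finite := by
  by_contra hinf
  obtain ⟨α, -, hα⟩ := Set.Infinite.exists_accPt_of_subset_isCompact hinf hK inter_subset_left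
  obtain ⟨z, hz, hza⟩ := ((accPt_iff_frequently_nhdsNE.1 hα).and_eventually
    (hf α (mem_univ _)).eventually_analyticAt).exists
  exact hz.2 ((hc z).unique hza.isPrincPart_zero)

theorem IsPinning.eq_of_add_eq {L : Set ℂ} {s : ℂ} {R : Set ℂ} (hR : IsPinning L s R)
    {r₁ r₂ l₁ l₂ : ℂ} {n₁ n₂ : ℤ} (hr₁ : r₁ ∈ R) (hr₂ : r₂ ∈ R) (hl₁ : l₁ ∈ L) (hl₂ : l₂ ∈ L)
    (h : r₁ + n₁ * s + l₁ = r₂ + n₂ * s + l₂) : r₁ = r₂ ∧ n₁ = n₂ := by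
  have := (hR (r₁ + n₁ * s + l₁)).unique (y₁ := (r₁, n₁, l₁)) (y₂ := (r₂, n₂, l₂))
    ⟨hr₁, hl₁, rfl⟩ ⟨hr₂, hl₂, h⟩
  simp only [Prod.mk.injEq] at this
  exact ⟨this.1, this.2.1⟩

/-- Only finitely many points `r + n s` with `r` in a pinning are poles of an elliptic function. -/
theorem IsPinning.finite_princPart_ne_zero {L : Set ℂ} (hL : IsLattice L) {s : ℂ} {R : Set ℂ}
    (hR : IsPinning L s R) {f : ℂ → ℂ} (hf : IsElliptic L f)
    {c : ℂ → ℕ → ℂ} (hc : ∀ α, IsPrincPart f α (c α)) :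
    {p : ℂ × ℤ | p.1 ∈ R ∧ c (p.1 + p.2 * s) ≠ 0}.Finite := by
  obtain ⟨K, hK, hKL⟩ := hL.exists_isCompact_add_mem
  choose l hlL hlK using hKL
  refine Set.Finite.of_finite_image (f := fun p : ℂ × ℤ => p.1 + p.2 * s + l (p.1 + p.2 * s))
    ((hf.1.finite_princPart_ne_zero hc hK).subset ?_) ?_
  · rintro _ ⟨p, hp, rfl⟩
    refine ⟨hlK _, ?_⟩
    rw [mem_ofPred_eq, hf.princPart_add_mem hc (hlL _)]
    exact hp.2
  · intro p hp q hq hpq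
    have := hR.eq_of_add_eq hp.1 hq.1 (hlL _) (hlL _) hpq
    exact Prod.ext this.1 this.2

theorem IsPinning.bijOn {L : Set ℂ} (hL : IsLattice L) {s : ℂ} {R R' : Set ℂ}
    (hR : IsPinning L s R) (hR' : IsPinning L s R') {ρ : ℂ → ℂ} {nn : ℂ → ℤ} {lam : ℂ → ℂ}
    (hmatch : ∀ r ∈ R, ρ r ∈ R' ∧ lam r ∈ L ∧ ρ r = r + (nn r : ℂ) * s + lam r) :
    BijOn ρ R R' := by
  refine ⟨fun r hr => (hmatch r hr).1, fun r₁ h₁ r₂ h₂ h => ?_, fun r' hr' => ?_⟩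
  · obtain ⟨-, hl₁, e₁⟩ := hmatch r₁ h₁
    obtain ⟨-, hl₂, e₂⟩ := hmatch r₂ h₂
    exact (hR.eq_of_add_eq h₁ h₂ hl₁ hl₂ (e₁ ▸ e₂ ▸ h)).1
  · obtain ⟨⟨r, n, l⟩, ⟨hr, hl, e⟩, -⟩ := hR r'
    obtain ⟨hρ, hlr, eρ⟩ := hmatch r hr
    refine ⟨r, hr, (hR'.eq_of_add_eq (n₁ := 0) (n₂ := nn r - n) hρ hr' hL.zero_mem
      (hL.sub_mem hlr hl) ?_).1⟩
    rw [eρ, e]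
    push_cast
    ring

theorem stmt4 (L : Set ℂ) (hL : IsLattice L) (s : ℂ)
    (hs : ∀ n : ℕ, 1 ≤ n → (n : ℂ) * s ∉ L)
    (R R' : Set ℂ) (hR : IsPinning L s R) (hR' : IsPinning L s R')
    (f : ℂ → ℂ) (hf : IsElliptic L f)
    (c : ℂ → ℕ → ℂ) (hc : ∀ α : ℂ, IsPrincPart f α (c α))
    (ρ : ℂ → ℂ) (nn : ℂ → ℤ) (lam : ℂ → ℂ)
    (hmatch : ∀ r ∈ R, ρ r ∈ R' ∧ lam r ∈ L ∧ ρ r = r + (nn r : ℂ) * s + lam r) :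
    (∑ᶠ r' ∈ R', ∑ᶠ n : ℤ, (n : ℂ) * c (r' + (n : ℂ) * s) 1)
      = (∑ᶠ r ∈ R, ∑ᶠ n : ℤ, (n : ℂ) * c (r + (n : ℂ) * s) 1)
        - ∑ᶠ r ∈ R, (nn r : ℂ) * (∑ᶠ n : ℤ, c (r + (n : ℂ) * s) 1) ∧
    ((∀ r ∈ R, (∑ᶠ n : ℤ, c (r + (n : ℂ) * s) 1) = 0) →
      (∑ᶠ r' ∈ R', ∑ᶠ n : ℤ, (n : ℂ) * c (r' + (n : ℂ) * s) 1)
        = ∑ᶠ r ∈ R, ∑ᶠ n : ℤ, (n : ℂ) * c (r + (n : ℂ) * s) 1) := by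
  have hfin := hR.finite_princPart_ne_zero hL hf hc
  have hne {α : ℂ} (h : c α 1 ≠ 0) : c α ≠ 0 := fun h0 => h (by rw [h0]; rfl)
  have hfin_n (r : ℂ) (hr : r ∈ R) : {n : ℤ | c (r + n * s) 1 ≠ 0}.Finite :=
    Set.Finite.of_finite_image (f := fun n : ℤ => (r, n))
      (hfin.subset (by rintro _ ⟨n, hn, rfl⟩; exact ⟨hr, hne hn⟩))
      (fun _ _ _ _ h => (Prod.mk.inj h).2)
  have hfin_r (F : ℂ → ℂ) (hF : ∀ r, (∀ n : ℤ, c (r + n * s) 1 = 0) → F r = 0) :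
      (R ∩ Function.support F).Finite := by
    refine (hfin.image Prod.fst).subset ?_
    rintro r ⟨hr, hFr⟩
    obtain ⟨n, hn⟩ := not_forall.1 (mt (hF r) hFr)
    exact ⟨(r, n), ⟨hr, hne hn⟩, rfl⟩
  have hmain : (∑ᶠ r' ∈ R', ∑ᶠ n : ℤ, (n : ℂ) * c (r' + (n : ℂ) * s) 1)
      = (∑ᶠ r ∈ R, ∑ᶠ n : ℤ, (n : ℂ) * c (r + (n : ℂ) * s) 1)
        - ∑ᶠ r ∈ R, (nn r : ℂ) * (∑ᶠ n : ℤ, c (r + (n : ℂ) * s) 1) := by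
    simp only [sub_eq_add_neg, ← finsum_neg_distrib]
    rw [← finsum_mem_add_distrib' (hfin_r _ fun r h => by simp [h])
      (hfin_r _ fun r h => by simp [h])]
    simp only [← sub_eq_add_neg]
    refine (finsum_mem_eq_of_bijOn ρ (hR.bijOn hL hR' hmatch) fun r hr => ?_).symm
    obtain ⟨-, hl, e⟩ := hmatch r hr
    have hsupp (w : ℤ → ℂ) :
        (Function.support fun n : ℤ => w n * c (r + (n : ℂ) * s) 1).Finite :=
      (hfin_n r hr).subset fun n hn => right_ne_zero_of_mul hn
    rw [mul_finsum,
      ← finsum_sub_distrib (hsupp _) (hsupp _), ← finsum_comp_equiv (Equiv.addRight (nn r))]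
    refine finsum_congr fun n => ?_
    have : ρ r + (n : ℂ) * s = r + ((n + nn r : ℤ) : ℂ) * s + lam r := by
      rw [e]
      push_cast
      ring
    rw [this, hf.princPart_add_mem hc hl, Equiv.coe_addRight]
    push_cast
    ring
  refine ⟨hmain, fun h => ?_⟩
  rw [hmain, sub_eq_self]
  exact finsum_mem_of_eqOn_zero fun r hr => by simp [h r hr]
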